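/- Let t be a real number with 1/2 < t < √2/2 and set α = 2·arccos(t). If c₁ ≥ 0 is a real number satisfying cos²α = (cosh²(c₁)·sin²α − 1)·(sin²α/(1−t²) − 1), then cosh²(c₁) = t²/((4t²−1)(1−t²)) and c₁ = log((2t+1)(1−t)/√((4t²−1)(1−t²))). -/

import Mathlib

open Real

theorem segment_c1_formula (t : ℝ) (h0 : 1 / 2 < t) (h1 : t < Real.sqrt 2 / 2)
    (c₁ : ℝ) (hc₁ : 0 ≤ c₁)
    (heq : cos (2 * arccos t) ^ 2 =
        (Real.cosh c₁ ^ 2 * sin (2 * arccos t) ^ 2 - 1) *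
          (sin (2 * arccos t) ^ 2 / (1 - t ^ 2) - 1)) :
    Real.cosh c₁ ^ 2 = t ^ 2 / ((4 * t ^ 2 - 1) * (1 - t ^ 2)) ∧
    c₁ = log ((2 * t + 1) * (1 - t) / Real.sqrt ((4 * t ^ 2 - 1) * (1 - t ^ 2))) := by
  have h2 : Real.sqrt 2 ^ 2 = 2 := Real.sq_sqrt (by norm_num)
  have ht2 : 2 * t ^ 2 < 1 := by nlinarith [Real.sqrt_nonneg 2]
  have ht1 : t < 1 := by nlinarith
  have hA : 0 < 4 * t ^ 2 - 1 := by nlinarith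
  have hB : 0 < 1 - t ^ 2 := by nlinarith
  have hcos : cos (arccos t) = t := Real.cos_arccos (by linarith) (by linarith)
  have hsin : sin (arccos t) ^ 2 = 1 - t ^ 2 := by
    rw [Real.sin_sq, hcos]
  have hS : sin (2 * arccos t) ^ 2 = 4 * t ^ 2 * (1 - t ^ 2) := by
    rw [Real.sin_two_mul, hcos, mul_pow, mul_pow, hsin]; ring
  have hC : cos (2 * arccos t) = 2 * t ^ 2 - 1 := by
    rw [Real.cos_two_mul, hcos]
  rw [hS, hC, mul_div_assoc, div_self hB.ne', mul_one] at heq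
  have hD := mul_pos hA hB
  have key : Real.cosh c₁ ^ 2 = t ^ 2 / ((4 * t ^ 2 - 1) * (1 - t ^ 2)) := by
    rw [eq_div_iff hD.ne']
    have h4 : (4 * t ^ 2) ≠ 0 := by positivity
    apply mul_left_cancel₀ h4
    linarith
  refine ⟨key, ?_⟩
  set D := (4 * t ^ 2 - 1) * (1 - t ^ 2) with hDdef
  have hs : 0 < Real.sqrt D := Real.sqrt_pos.2 hD
  have hsq : Real.sqrt D ^ 2 = D := Real.sq_sqrt hD.le
  have hch : Real.cosh c₁ = t / Real.sqrt D := by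
    refine (pow_left_inj₀ (Real.cosh_pos _).le (by positivity) two_ne_zero).1 ?_
    rw [key, div_pow, hsq]
  have hsh : Real.sinh c₁ = (1 - 2 * t ^ 2) / Real.sqrt D := by
    refine (pow_left_inj₀ (Real.sinh_nonneg_iff.2 hc₁)
      (div_nonneg (by linarith) hs.le) two_ne_zero).1 ?_
    rw [Real.sinh_sq, key, div_pow, hsq, div_sub_one hD.ne']
    congr 1
    rw [hDdef]; ring
  have he : (2 * t + 1) * (1 - t) / Real.sqrt D = Real.exp c₁ := by
    rw [← Real.cosh_add_sinh, hch, hsh]; ring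
  rw [he, Real.log_exp]
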